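/- Let k, q be natural numbers with k ≥ 2, let W₁, …, W_k be nonzero vectors in ℝ^q (the rows of the weight matrix of the classifier h) and let v⁽¹⁾, …, v⁽ᵏ⁾ be nonzero vectors in ℝ^q (feature vectors, one per class). Assume: (i) for every class l and every i ≠ l, exp(⟨W_i, v⁽ˡ⁾⟩) = 1 (the exact form of the well-trained condition (2)); and (ii) for every l, ⟨W_l, v⁽ˡ⁾⟩ = ‖W_l‖ · ‖v⁽ˡ⁾‖, i.e. the maximum of the dot product is attained. Then the weight vectors are mutually orthogonal: ⟨W_i, W_j⟩ = 0 for all i ≠ j. -/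

import Mathlib

open scoped RealInnerProductSpace

/-- Lemma 1 (Orthogonality of Weight Vectors), exact-equality form:
if for each class `l` the feature vector `v l` satisfies
`exp ⟪W i, v l⟫ = 1` for all `i ≠ l` and the maximum `⟪W l, v l⟫ = ‖W l‖ * ‖v l‖`
is attained, then the weight vectors are mutually orthogonal. -/
theorem weight_vectors_orthogonal
    (k q : ℕ) (hk : 2 ≤ k)
    (W : Fin k → EuclideanSpace ℝ (Fin q))
    (v : Fin k → EuclideanSpace ℝ (Fin q))
    (hW : ∀ i, W i ≠ 0) (hv : ∀ l, v l ≠ 0)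
    (hcond2 : ∀ l i, i ≠ l → Real.exp ⟪W i, v l⟫ = 1)
    (hmax : ∀ l, ⟪W l, v l⟫ = ‖W l‖ * ‖v l‖) :
    ∀ i j, i ≠ j → ⟪W i, W j⟫ = 0 := by
  intro i j hij
  have hperp : ⟪W i, v j⟫ = 0 := Real.exp_eq_one_iff _ |>.mp (hcond2 j i hij)
  have hparallel : ‖v j‖ • W j = ‖W j‖ • v j := inner_eq_norm_mul_iff_real.mp (hmax j)
  have hscaled : ‖v j‖ * ⟪W i, W j⟫ = 0 := by
    rw [← real_inner_smul_right, hparallel, real_inner_smul_right, hperp, mul_zero]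
  exact (mul_eq_zero.mp hscaled).resolve_left (norm_ne_zero_iff.mpr (hv j))
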